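/- For every nonzero t₃ ∈ ℂ, the 6×6 matrix M₃(t₃), viewed over the field of rational functions ℂ(q), with rows (0, 0, 3t₃q, 0, 4q, 0), (4, 0, 0, 0, 0, 4q), (0, 4, 0, 0, 0, 3t₃q), (−t₃, 4, 0, 0, 0, 0), (0, −t₃, 4, 4, 0, 0), (0, 0, 0, −t₃, 4, 0), has squarefree characteristic polynomial; equivalently, the resultant of its characteristic polynomial with its derivative is nonzero, i.e. M₃(t₃) has simple spectrum. -/

import Mathlib

/-- The resultant of two polynomials `p` and `q`, computed as the determinant of
the Sylvester matrix built with respect to the degree bounds `m` for `p` and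
`n` for `q`. -/
noncomputable def sylvesterRes {R : Type*} [CommRing R] (m n : ℕ)
    (p q : Polynomial R) : R :=
  (Matrix.of (fun i j : Fin (m + n) =>
    if (i : ℕ) < n then
      (if (j : ℕ) ≤ m + (i : ℕ) then p.coeff (m + (i : ℕ) - (j : ℕ)) else 0)
    else
      (if (j : ℕ) ≤ ((i : ℕ) - n) + n then
        q.coeff (((i : ℕ) - n) + n - (j : ℕ)) else 0))).det

open RatFunc in
/-- The energy-2 truncation of the Dubrovin operator of `Gr(2,4)` with bulk
parameter supported on the Schubert class `σ₍₁,₁₎`, viewed over `ℂ(q)`. -/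
noncomputable def M3R (t : ℂ) : Matrix (Fin 6) (Fin 6) (RatFunc ℂ) :=
  !![0,       0,       C (3 * t) * X, 0,       4 * X, 0;
     4,       0,       0,             0,       0,     4 * X;
     0,       4,       0,             0,       0,     C (3 * t) * X;
     C (-t),  4,       0,             0,       0,     0;
     0,       C (-t),  4,             4,       0,     0;
     0,       0,       0,             C (-t),  4,     0]

open Polynomial

/-- `sylvesterRes` is the determinant of the Sylvester matrix with both index sets reversed,
transposed. -/
lemma sylvesterRes_eq_resultant {R : Type*} [CommRing R] {m n : ℕ} {p q : R[X]}
    (hp : p.natDegree ≤ m) (hq : q.natDegree ≤ n) :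
    sylvesterRes m n p q = resultant p q m n := by
  rw [resultant, ← Matrix.det_transpose, ← Matrix.det_submatrix_equiv_self Fin.revPerm,
    sylvesterRes]
  congr 1
  ext i j
  simp only [Matrix.of_apply, Matrix.submatrix_apply, Matrix.transpose_apply, sylvester,
    Fin.revPerm_apply]
  obtain ⟨k, rfl⟩ := Fin.revPerm.surjective i
  simp only [Fin.revPerm_apply, Fin.rev_rev, Fin.val_rev, Set.mem_Icc]
  refine k.addCases (fun a ↦ ?_) (fun a ↦ ?_)
  · have hna : ¬ m + n - (a + 1) < n := by lia
    simp only [Fin.addCases_left, Fin.val_castAdd, hna, if_false]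
    split_ifs with h₁ h₂ h₂
    · congr 1; lia
    · exact coeff_eq_zero_of_natDegree_lt (by lia)
    · lia
    · rfl
  · have hna : m + n - (m + a + 1) < n := by lia
    simp only [Fin.addCases_right, Fin.val_natAdd, hna, if_true]
    split_ifs with h₁ h₂ h₂
    · congr 1; lia
    · exact coeff_eq_zero_of_natDegree_lt (by lia)
    · lia
    · rfl

/-- The matrix `M3R` over an arbitrary commutative ring, with both parameters free. -/
def dubrovinMatrix {R : Type*} [CommRing R] (t q : R) : Matrix (Fin 6) (Fin 6) R :=
  !![0,  0,  3 * t * q, 0,  4 * q, 0;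
     4,  0,  0,         0,  0,     4 * q;
     0,  4,  0,         0,  0,     3 * t * q;
     -t, 4,  0,         0,  0,     0;
     0,  -t, 4,         4,  0,     0;
     0,  0,  0,         -t, 4,     0]

lemma dubrovinMatrix_map {R S : Type*} [CommRing R] [CommRing S] (f : R →+* S) (t q : R) :
    (dubrovinMatrix t q).map f = dubrovinMatrix (f t) (f q) := by
  ext i j
  fin_cases i <;> fin_cases j <;> simp [dubrovinMatrix, map_ofNat f]

lemma M3R_eq_dubrovinMatrix (t : ℂ) : M3R t = dubrovinMatrix (RatFunc.C t) RatFunc.X := by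
  simp [M3R, dubrovinMatrix, map_ofNat (RatFunc.C (K := ℂ))]

lemma charpoly_dubrovinMatrix {R : Type*} [CommRing R] (t q : R) :
    (dubrovinMatrix t q).charpoly =
      X ^ 6 - C (32 * t * q) * X ^ 3 - C (9 * t ^ 4 * q ^ 2 + 1024 * q) * X ^ 2
        + C (352 * t ^ 3 * q ^ 2) * X - C (1024 * t ^ 2 * q ^ 2) := by
  have h : (dubrovinMatrix t q).charmatrix =
      !![X,    0,    -C (3 * t * q), 0,    -C (4 * q), 0;
         -4,   X,    0,              0,    0,          -C (4 * q);
         0,    -4,   X,              0,    0,          -C (3 * t * q);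
         C t,  -4,   0,              X,    0,          0;
         0,    C t,  -4,             -4,   X,          0;
         0,    0,    0,              C t,  -4,         X] := by
    ext1 i j
    fin_cases i <;> fin_cases j <;> simp [dubrovinMatrix, map_ofNat (C (R := R))]
  rw [Matrix.charpoly, h]
  simp [Matrix.det_succ_row_zero, Fin.sum_univ_succ, Fin.succAbove, map_ofNat (C (R := R))]
  ring

/-- Specializing `q` so that `t ^ 4 * q = 128`, the characteristic polynomial becomes separable. -/
lemma separable_charpoly_dubrovinMatrix {t : ℂ} (ht : t ≠ 0) :
    (dubrovinMatrix t (128 / t ^ 4)).charpoly.Separable := by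
  rw [Separable, isCoprime_iff_aeval_ne_zero_of_isAlgClosed ℂ ℂ, charpoly_dubrovinMatrix]
  intro z
  by_contra! hz
  obtain ⟨h₀, h₁⟩ := hz
  simp only [coe_aeval_eq_eval, derivative_add, derivative_sub, derivative_C_mul, derivative_X_pow,
    derivative_X, derivative_C, eval_add, eval_sub, eval_mul, eval_pow, eval_X, eval_C, eval_one,
    eval_zero, map_natCast, eval_natCast] at h₀ h₁
  norm_num at h₀ h₁
  obtain ⟨w, rfl⟩ : ∃ w, z = w / t := ⟨z * t, by field_simp⟩
  have e₀ : w ^ 6 - 4096 * w ^ 3 - 278528 * w ^ 2 + 5767168 * w - 16777216 = 0 := by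
    field_simp at h₀
    linear_combination h₀
  have e₁ : 6 * w ^ 5 - 12288 * w ^ 2 - 557056 * w + 5767168 = 0 := by
    field_simp at h₁
    linear_combination h₁
  have h : (-407842019889643520 : ℂ) = 0 := by
    linear_combination
      (-10106273792 - 1689355776 * w - 110259456 * w ^ 2 - 5580348 * w ^ 3
        - 137598 * w ^ 4) * e₀
      + (-100117970944 - 4478701568 * w + 234592512 * w ^ 2 + 18376576 * w ^ 3
        + 930058 * w ^ 4 + 22933 * w ^ 5) * e₁
  norm_num at h

lemma natDegree_charpoly_dubrovinMatrix {R : Type*} [CommRing R] [Nontrivial R] (t q : R) :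
    (dubrovinMatrix t q).charpoly.natDegree = 6 := by
  simp [Matrix.charpoly_natDegree_eq_dim]

lemma natDegree_derivative_charpoly_dubrovinMatrix {K : Type*} [Field K] [CharZero K] (t q : K) :
    (dubrovinMatrix t q).charpoly.derivative.natDegree = 5 := by
  rw [natDegree_derivative, natDegree_charpoly_dubrovinMatrix]

lemma resultant_charpoly_dubrovinMatrix_map {R S : Type*} [CommRing R] [CommRing S] (f : R →+* S)
    (t q : R) :
    resultant (dubrovinMatrix (f t) (f q)).charpoly
        (dubrovinMatrix (f t) (f q)).charpoly.derivative 6 5 =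
      f (resultant (dubrovinMatrix t q).charpoly (dubrovinMatrix t q).charpoly.derivative 6 5) := by
  rw [← dubrovinMatrix_map, Matrix.charpoly_map, derivative_map, resultant_map_map]

lemma resultant_charpoly_dubrovinMatrix_ne_zero {t : ℂ} (ht : t ≠ 0) :
    resultant (dubrovinMatrix (RatFunc.C t) RatFunc.X).charpoly
      (dubrovinMatrix (RatFunc.C t) RatFunc.X).charpoly.derivative 6 5 ≠ 0 := by
  rw [← RatFunc.algebraMap_C, ← RatFunc.algebraMap_X, resultant_charpoly_dubrovinMatrix_map]
  refine (map_ne_zero_iff _ (RatFunc.algebraMap_injective ℂ)).2 fun h ↦ ?_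
  have hq := resultant_ne_zero _ _ (separable_charpoly_dubrovinMatrix ht)
  rw [natDegree_charpoly_dubrovinMatrix, natDegree_derivative_charpoly_dubrovinMatrix] at hq
  refine hq ?_
  have hev := resultant_charpoly_dubrovinMatrix_map (evalRingHom (128 / t ^ 4)) (C t) X
  rwa [h, map_zero, coe_evalRingHom, eval_C, eval_X] at hev

/-- For every `t ≠ 0`, the matrix `M3R t` has squarefree characteristic polynomial;
equivalently the resultant of its characteristic polynomial with its derivative is
nonzero, i.e. it has simple spectrum. -/
theorem simple_spectrum_M3R (t : ℂ) (ht : t ≠ 0) :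
    Squarefree (M3R t).charpoly ∧
      sylvesterRes 6 5 (M3R t).charpoly (M3R t).charpoly.derivative ≠ 0 := by
  have : CharZero (RatFunc ℂ) := charZero_of_injective_algebraMap (RatFunc.C (K := ℂ)).injective
  have hres := resultant_charpoly_dubrovinMatrix_ne_zero ht
  have hdeg := natDegree_charpoly_dubrovinMatrix (RatFunc.C t) RatFunc.X
  have hdeg' := natDegree_derivative_charpoly_dubrovinMatrix (RatFunc.C t) RatFunc.X
  rw [M3R_eq_dubrovinMatrix, sylvesterRes_eq_resultant hdeg.le hdeg'.le]
  refine ⟨Separable.squarefree ?_, hres⟩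
  rw [Separable, ← isUnit_resultant_iff_isCoprime (Matrix.charpoly_monic _), hdeg, hdeg']
  exact hres.isUnit
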